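/- Fix η,δ∈(0,1). There exist constants c_a∈(0,1) and C_P<∞, depending only on η and δ, such that for all N ≥ C_P, integers P∈[C_P,N], sets A⊆{1,…,P} with c_aP ≤ |A| ≤ P, and nonempty finite sets S_i⊆G (i∈A) satisfying δ|i−j|−1/δ ≤ d(y,z) ≤ (|i−j|+1/δ)·N/P for all i,j∈A, y∈S_i and z∈S_j, one has cap(∪_{i∈A}S_i) ≤ C₆(1+η)·F_ν(N,N/P), where C₆=C_β if ν≤1 and C₆=C₆(η,δ)<∞ if ν>1. -/

import Mathlib

open MeasureTheory Set Filter
open scoped ENNReal Topology Classical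

noncomputable section

namespace Paper

variable {V : Type}

/-- Total weight at a vertex: `λ_x = ∑_y λ_{x,y}`. -/
def lamTot (lam : V → V → ℝ) (x : V) : ℝ := ∑' y, lam x y

/-- Closed ball for the distance `dd`. -/
def vball (dd : V → V → ℝ) (x : V) (r : ℝ) : Set V := {y | dd x y ≤ r}

/-- Trajectories that never return to `A` after time `0`, i.e. `H̃_A = ∞`. -/
def avoidSet (A : Set V) : Set (ℕ → V) := {ω | ∀ k, 1 ≤ k → ω k ∉ A}

variable [MeasurableSpace V]

/-- Equilibrium measure `e_A(x) = λ_x P_x(H̃_A = ∞) 1{x ∈ A}`. -/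
def equi (lam : V → V → ℝ) (P : V → Measure (ℕ → V)) (A : Set V) (x : V) : ℝ :=
  if x ∈ A then lamTot lam x * (P x (avoidSet A)).toReal else 0

/-- Capacity `cap(A) = ∑_{x ∈ A} e_A(x)`. -/
def capa (lam : V → V → ℝ) (P : V → Measure (ℕ → V)) (A : Set V) : ℝ :=
  ∑' x : A, equi lam P A x

/-- Green function `g(x,y) = λ_y⁻¹ E_x[∑_k 1{X_k = y}]`. -/
def green (lam : V → V → ℝ) (P : V → Measure (ℕ → V)) (x y : V) : ℝ :=
  (lamTot lam y)⁻¹ * ∑' k : ℕ, (P x {ω | ω k = y}).toReal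

/-- The standing assumptions on the weighted graph `(G,λ)` with distance `dd`,
random-walk law `P`, volume exponent `α`, Green exponent `ν` and asymptotic
Green constants `c₃ ≤ C₃`. -/
structure Standing (lam dd : V → V → ℝ) (P : V → Measure (ℕ → V))
    (α ν c₃ C₃ : ℝ) : Prop where
  countable : Countable V
  lam_symm : ∀ x y, lam x y = lam y x
  lam_nonneg : ∀ x y, 0 ≤ lam x y
  lam_diag : ∀ x, lam x x = 0
  locFin : ∀ x, {y | 0 < lam x y}.Finite
  dd_self : ∀ x, dd x x = 0
  dd_pos : ∀ x y, x ≠ y → 0 < dd x y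
  dd_symm : ∀ x y, dd x y = dd y x
  dd_triangle : ∀ x y z, dd x z ≤ dd x y + dd y z
  prob : ∀ x, IsProbabilityMeasure (P x)
  start : ∀ x, P x {ω | ω 0 = x} = 1
  step : ∀ x y, P x {ω | ω 1 = y} = ENNReal.ofReal (lam x y / lamTot lam x)
  markov : ∀ (x y : V) (k : ℕ) (S : Set (ℕ → V)), MeasurableSet S →
    P x ({ω | ω k = y} ∩ {ω | (fun n => ω (k + n)) ∈ S}) = P x {ω | ω k = y} * P y S
  nu_pos : 0 < ν
  nu_le : ν ≤ α - 2
  vol : ∃ c₁ C₁ : ℝ, 0 < c₁ ∧ c₁ ≤ C₁ ∧ ∀ (x : V) (r : ℝ), 1 ≤ r →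
    c₁ * r ^ α ≤ ∑' y : vball dd x r, lamTot lam y ∧
      ∑' y : vball dd x r, lamTot lam y ≤ C₁ * r ^ α
  greenBounds : ∃ c₂ C₂ : ℝ, 0 < c₂ ∧ c₂ ≤ C₂ ∧
    (∀ x, c₂ ≤ green lam P x x ∧ green lam P x x ≤ C₂) ∧
    ∀ x y, x ≠ y → c₂ * dd x y ^ (-ν) ≤ green lam P x y ∧
      green lam P x y ≤ C₂ * dd x y ^ (-ν)
  c₃_pos : 0 < c₃
  c₃_le_C₃ : c₃ ≤ C₃
  greenAsymp : ∀ η' : ℝ, 0 < η' → ∃ M : ℝ, ∀ x y, M ≤ dd x y →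
    (1 - η') * c₃ ≤ green lam P x y * dd x y ^ ν ∧
      green lam P x y * dd x y ^ ν ≤ (1 + η') * C₃
  p0 : ∃ c : ℝ, 0 < c ∧ ∀ x y, 0 < lam x y → c ≤ lam x y / lamTot lam x

/-- The geodesic assumption: from every point there is an infinite
nearest-neighbour path along which `dd` is comparable to the index difference. -/
def Geodesic (lam dd : V → V → ℝ) (c₄ C₄ : ℝ) : Prop :=
  ∀ x : V, ∃ γ : ℕ → V, γ 0 = x ∧ (∀ k : ℕ, 0 < lam (γ k) (γ (k + 1))) ∧
    ∀ k p : ℕ, c₄ * |(k : ℝ) - (p : ℝ)| - C₄ ≤ dd (γ k) (γ p) ∧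
      dd (γ k) (γ p) ≤ c₄ * |(k : ℝ) - (p : ℝ)| + C₄

/-- The function `F_ν(x,y)`. -/
def Fnu (ν x y : ℝ) : ℝ :=
  if ν < 1 then x ^ ν
  else if ν = 1 then x / max 1 (Real.log (x / y))
  else x * y ^ (ν - 1)

/-- `F_ν(x) = F_ν(x,1)`. -/
def Fnu1 (ν x : ℝ) : ℝ := Fnu ν x 1

/-- The constant `π⁻¹ B((1+ν)/2,(1+ν)/2) cos(πν/2)` for `ν < 1` and `1/2` for `ν = 1`
(the Beta function expressed through `Γ`). -/
def kappaNu (ν : ℝ) : ℝ :=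
  if ν < 1 then
    Real.Gamma ((1 + ν) / 2) * Real.Gamma ((1 + ν) / 2) / Real.Gamma (1 + ν)
      * Real.cos (Real.pi * ν / 2) / Real.pi
  else 1 / 2

/-- `c_β`, defined by `c_β · C₃ = kappaNu ν`. -/
def cBeta (ν C₃ : ℝ) : ℝ := kappaNu ν / C₃

/-- `C_β`, defined by `C_β · c₃ = kappaNu ν`. -/
def CBeta (ν c₃ : ℝ) : ℝ := kappaNu ν / c₃

/-- `a` and `b` are joined by a nearest-neighbour path inside `S`. -/
def connIn (lam : V → V → ℝ) (S : Set V) (a b : V) : Prop :=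
  ∃ (m : ℕ) (γ : ℕ → V), γ 0 = a ∧ γ m = b ∧ (∀ i ≤ m, γ i ∈ S) ∧
    ∀ i < m, 0 < lam (γ i) (γ (i + 1))

/-- The set `X̄_A` of points visited by a trajectory strictly before exiting `A`. -/
def visited (A : Set V) (ω : ℕ → V) : Set V :=
  {v | ∃ k : ℕ, (∀ n ≤ k, ω n ∈ A) ∧ ω k = v}

section Walk

variable {lam dd : V → V → ℝ} {P : V → Measure (ℕ → V)} {α ν c₃ C₃ : ℝ}

lemma Standing.summable_lam (h : Standing lam dd P α ν c₃ C₃) (x : V) : Summable (lam x) :=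
  summable_of_hasFiniteSupport <| (h.locFin x).subset fun y hy =>
    lt_of_le_of_ne (h.lam_nonneg x y) (Ne.symm hy)

lemma Standing.lamTot_pos (h : Standing lam dd P α ν c₃ C₃) (x : V) : 0 < lamTot lam x := by
  refine lt_of_le_of_ne (tsum_nonneg (h.lam_nonneg x)) fun h0 => ?_
  obtain ⟨c₂, C₂, hc₂, -, hg, -⟩ := h.greenBounds
  have := (hg x).1
  rw [green, ← h0, inv_zero, zero_mul] at this
  linarith

lemma Standing.exists_lam_pos (h : Standing lam dd P α ν c₃ C₃) (y : V) : ∃ x, 0 < lam x y := by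
  by_contra! hc
  have h0 : lamTot lam y = 0 := by
    have : lam y = fun _ => 0 := funext fun x =>
      le_antisymm (h.lam_symm y x ▸ hc x) (h.lam_nonneg y x)
    simp [lamTot, this]
  exact (h.lamTot_pos y).ne' h0

lemma Standing.tsum_step (h : Standing lam dd P α ν c₃ C₃) (x : V) :
    ∑' y, P x {ω | ω 1 = y} = 1 := by
  simp_rw [h.step]
  rw [← ENNReal.ofReal_tsum_of_nonneg
    (fun y => div_nonneg (h.lam_nonneg x y) (h.lamTot_pos x).le) ((h.summable_lam x).div_const _),
    tsum_div_const]
  change ENNReal.ofReal (lamTot lam x / lamTot lam x) = 1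
  rw [div_self (h.lamTot_pos x).ne', ENNReal.ofReal_one]

/-- The measure of `{ω | ω k = y}` only sees the atom of the `σ`-algebra containing `y`. -/
lemma measure_eval_measurableAtom (μ : Measure (ℕ → V)) (k : ℕ) (y : V) :
    μ {ω | ω k ∈ measurableAtom y} = μ {ω | ω k = y} := by
  refine le_antisymm ?_ (measure_mono fun ω (hω : ω k = y) => by
    change ω k ∈ measurableAtom y
    rw [hω]; exact mem_measurableAtom_self y)
  rw [← measure_toMeasurable {ω : ℕ → V | ω k = y}]
  refine measure_mono fun ω hω => ?_
  have hm : Measurable fun v : V => Function.update ω k v := measurable_update ω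
  have := measurableAtom_subset (x := y)
    (hm (measurableSet_toMeasurable μ {ω : ℕ → V | ω k = y}))
    (subset_toMeasurable _ _ (by simp)) hω
  simpa using this

lemma Standing.measurableSingletonClass (h : Standing lam dd P α ν c₃ C₃) :
    MeasurableSingletonClass V := by
  have := h.countable
  refine ⟨fun y => ?_⟩
  suffices hy : measurableAtom y = {y} from hy ▸ MeasurableSet.measurableAtom_of_countable y
  refine Subset.antisymm (fun y' hy' => ?_) (by simp)
  by_contra hne
  obtain ⟨x, hx⟩ := h.exists_lam_pos y'
  have := h.prob x
  have hpos : P x {ω | ω 1 = y'} ≠ 0 := by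
    rw [h.step]
    exact (ENNReal.ofReal_pos.2 (div_pos hx (h.lamTot_pos x))).ne'
  have hcov : (1 : ℝ≥0∞) ≤ ∑' z : ({y'}ᶜ : Set V), P x {ω | ω 1 = (z : V)} := by
    rw [← measure_univ (μ := P x)]
    refine le_trans (measure_mono fun ω _ => ?_) ((measure_iUnion_le fun z : ({y'}ᶜ : Set V) =>
      {ω : ℕ → V | ω 1 ∈ measurableAtom (z : V)}).trans
      (ENNReal.tsum_le_tsum fun z => (measure_eval_measurableAtom _ _ _).le))
    by_cases hω : ω 1 = y'
    · exact mem_iUnion.2 ⟨⟨y, fun h => hne h.symm⟩, by simpa [hω] using hy'⟩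
    · exact mem_iUnion.2 ⟨⟨ω 1, hω⟩, mem_measurableAtom_self _⟩
  have hsplit := h.tsum_step x
  rw [← Summable.tsum_add_tsum_compl (f := fun y => P x {ω | ω 1 = y}) (s := {y'})
    ENNReal.summable ENNReal.summable, tsum_singleton y' fun y => P x {ω | ω 1 = y}] at hsplit
  have hlt : (1 : ℝ≥0∞) < P x {ω | ω 1 = y'} + 1 := by
    rw [add_comm]; exact ENNReal.lt_add_right ENNReal.one_ne_top hpos
  exact absurd hsplit (hlt.trans_le (by gcongr)).ne'

/-- Last-exit decomposition: the equilibrium potential of a finite set is at most `1`. -/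
lemma Standing.sum_green_mul_equi_le_one (h : Standing lam dd P α ν c₃ C₃) (K : Finset V) (x : V) :
    ∑ y ∈ K, green lam P x y * equi lam P K y ≤ 1 := by
  have := h.measurableSingletonClass
  have := h.prob
  have hK : MeasurableSet (avoidSet (K : Set V)) := by
    have : avoidSet (K : Set V) = ⋂ k, ⋂ (_ : 1 ≤ k), (fun ω : ℕ → V => ω k) ⁻¹' (K : Set V)ᶜ := by
      ext ω; simp [avoidSet]
    rw [this]
    exact MeasurableSet.iInter fun k => MeasurableSet.iInter fun _ =>
      K.measurableSet.compl.preimage (measurable_pi_apply k)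
  set E : ℕ → V → Set (ℕ → V) := fun k y =>
    {ω | ω k = y} ∩ {ω | (fun n => ω (k + n)) ∈ avoidSet (K : Set V)} with hE
  have hEm : ∀ k y, MeasurableSet (E k y) := fun k y =>
    MeasurableSet.inter
      (show MeasurableSet ((fun ω : ℕ → V => ω k) ⁻¹' {y}) from
        (measurableSet_singleton y).preimage (measurable_pi_apply k))
      (show MeasurableSet ((fun (ω : ℕ → V) n => ω (k + n)) ⁻¹' avoidSet (K : Set V)) from
        hK.preimage (measurable_pi_lambda _ fun n => measurable_pi_apply (k + n)))
  have hdisj : Pairwise (Function.onFun Disjoint fun q : ℕ × K => E q.1 q.2) := by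
    have key : ∀ (k l : ℕ) (y z : K) ω, k < l → ω ∈ E k y → ω ∈ E l z → False := by
      intro k l y z ω hkl h1 h2
      have h3 := h1.2 (l - k) (by omega)
      simp only [Nat.add_sub_cancel' hkl.le] at h3
      have h4 : ω l = z := h2.1
      exact h3 (h4 ▸ z.2)
    rintro ⟨k, y⟩ ⟨l, z⟩ hne
    refine Set.disjoint_left.2 fun ω h1 h2 => ?_
    rcases lt_trichotomy k l with hkl | rfl | hkl
    · exact key _ _ _ _ _ hkl h1 h2
    · have h3 : ω k = y := h1.1
      have h4 : ω k = z := h2.1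
      exact hne (Prod.ext rfl (Subtype.ext (h3.symm.trans h4)))
    · exact key _ _ _ _ _ hkl h2 h1
  have hle : ∑' q : ℕ × K, P x (E q.1 q.2) ≤ 1 := by
    rw [← measure_iUnion hdisj fun q => hEm _ _]
    exact prob_le_one
  have hterm : ∀ y ∈ K, green lam P x y * equi lam P K y =
      (∑' k, P x (E k y)).toReal := by
    intro y hy
    have hy' : y ∈ (K : Set V) := hy
    rw [equi, if_pos hy', green]
    simp_rw [hE, h.markov x y _ _ hK]
    rw [ENNReal.tsum_mul_right, ENNReal.toReal_mul,
      ENNReal.tsum_toReal_eq fun k => measure_ne_top _ _]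
    have := (h.lamTot_pos y).ne'
    field_simp
  have hsum : ∑ y ∈ K, ∑' k, P x (E k y) ≤ 1 := by
    rw [← Finset.sum_coe_sort K fun y => ∑' k, P x (E k y), ← tsum_fintype (L := .unconditional _)]
    rwa [ENNReal.tsum_comm, ← ENNReal.tsum_prod (f := fun k (y : K) => P x (E k y))]
  rw [Finset.sum_congr rfl hterm, ← ENNReal.toReal_sum]
  · exact ENNReal.toReal_mono ENNReal.one_ne_top hsum
  · exact fun y hy => ne_top_of_le_ne_top ENNReal.one_ne_top
      ((Finset.single_le_sum (fun _ _ => zero_le) hy).trans hsum)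

end Walk

section MaximumPrinciple

lemma convexOn_rpow_neg {p : ℝ} (hp : 0 < p) : ConvexOn ℝ (Ioi 0) fun x : ℝ => x ^ (-p) := by
  refine convexOn_of_hasDerivWithinAt2_nonneg (convex_Ioi 0)
    (f' := fun x => -p * x ^ (-p - 1)) (f'' := fun x => -p * ((-p - 1) * x ^ (-p - 1 - 1)))
    (fun x hx => (Real.continuousAt_rpow_const x (-p) (Or.inl (ne_of_gt hx))).continuousWithinAt)
    (fun x hx => ?_) (fun x hx => ?_) (fun x hx => ?_)
  all_goals rw [interior_Ioi] at hx
  · exact (Real.hasDerivAt_rpow_const (Or.inl (ne_of_gt hx))).hasDerivWithinAt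
  · exact ((Real.hasDerivAt_rpow_const (Or.inl (ne_of_gt hx))).const_mul (-p)).hasDerivWithinAt
  · have := Real.rpow_nonneg (le_of_lt hx) (-p - 1 - 1)
    rw [← mul_assoc]
    exact mul_nonneg (by nlinarith) this

lemma convexOn_rpow_neg_add {p c : ℝ} (hp : 0 < p) (hc : 0 < c) :
    ConvexOn ℝ (Ici 0) fun x : ℝ => (x + c) ^ (-p) := by
  refine ((convexOn_rpow_neg hp).translate_left c).subset (fun x hx => ?_) (convex_Ici 0)
  have hx' : 0 ≤ x := hx
  change 0 < c + x
  linarith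

lemma antitoneOn_rpow_neg_add {p c : ℝ} (hp : 0 < p) (hc : 0 < c) :
    AntitoneOn (fun x : ℝ => (x + c) ^ (-p)) (Ici 0) := fun x hx y _ hxy =>
  Real.rpow_le_rpow_of_nonpos (add_pos_of_nonneg_of_pos hx hc) (by linarith) (by linarith)

/-- Maximum principle for one-dimensional potentials with a convex decreasing kernel. -/
lemma sum_kernel_le_of_forall_mem {A : Finset ℕ} (hA : A.Nonempty) {e : ℕ → ℝ}
    (he : ∀ j ∈ A, 0 ≤ e j) {k : ℝ → ℝ} (hk : ConvexOn ℝ (Ici 0) k) (hanti : AntitoneOn k (Ici 0))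
    {D : ℝ} (hD : ∀ i ∈ A, ∑ j ∈ A, e j * k |(i : ℝ) - j| ≤ D) (t : ℝ) :
    ∑ j ∈ A, e j * k |t - j| ≤ D := by
  have outside : ∀ a ∈ A, (∀ j ∈ A, |(a : ℝ) - j| ≤ |t - j|) → ∑ j ∈ A, e j * k |t - j| ≤ D :=
    fun a ha h => (Finset.sum_le_sum fun j hj => mul_le_mul_of_nonneg_left
      (hanti (mem_Ici.2 (abs_nonneg _)) (mem_Ici.2 (abs_nonneg _)) (h j hj)) (he j hj)).trans (hD a ha)
  by_cases hL : ∃ j ∈ A, (j : ℝ) ≤ t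
  swap
  · push Not at hL
    refine outside _ (A.min'_mem hA) fun j hj => ?_
    have h1 : ((A.min' hA : ℕ) : ℝ) ≤ j := by exact_mod_cast A.min'_le j hj
    have h2 := hL _ (A.min'_mem hA)
    rw [abs_of_nonpos (by linarith), abs_of_nonpos (by linarith)]
    linarith
  by_cases hR : ∃ j ∈ A, t ≤ (j : ℝ)
  swap
  · push Not at hR
    refine outside _ (A.max'_mem hA) fun j hj => ?_
    have h1 : (j : ℝ) ≤ (A.max' hA : ℕ) := by exact_mod_cast A.le_max' j hj
    have h2 := hR _ (A.max'_mem hA)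
    rw [abs_of_nonneg (by linarith), abs_of_nonneg (by linarith)]
    linarith
  obtain ⟨a, ha, hamax⟩ := (A.filter fun j : ℕ => (j : ℝ) ≤ t).exists_max_image (fun j => j)
    (let ⟨j, hj, h⟩ := hL; ⟨j, Finset.mem_filter.2 ⟨hj, h⟩⟩)
  obtain ⟨b, hb, hbmin⟩ := (A.filter fun j : ℕ => t ≤ (j : ℝ)).exists_min_image (fun j => j)
    (let ⟨j, hj, h⟩ := hR; ⟨j, Finset.mem_filter.2 ⟨hj, h⟩⟩)
  rw [Finset.mem_filter] at ha hb
  obtain ⟨x, y, hx, hy, hxy, ht⟩ : t ∈ segment ℝ (a : ℝ) b := by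
    rw [segment_eq_Icc (ha.2.trans hb.2)]; exact ⟨ha.2, hb.2⟩
  simp only [smul_eq_mul] at ht
  have hterm : ∀ j ∈ A, e j * k |t - j| ≤
      x * (e j * k |(a : ℝ) - j|) + y * (e j * k |(b : ℝ) - j|) := by
    intro j hj
    have habs : |t - j| = x * |(a : ℝ) - j| + y * |(b : ℝ) - j| := by
      have hj' : t - j = x * (a - j) + y * (b - j) := by rw [← ht]; linear_combination (j : ℝ) * hxy
      rcases le_total (j : ℝ) t with hjt | hjt
      · have h1 : (j : ℝ) ≤ a := by
          exact_mod_cast hamax j (Finset.mem_filter.2 ⟨hj, hjt⟩)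
        rw [abs_of_nonneg (by linarith), abs_of_nonneg (by linarith),
          abs_of_nonneg (by linarith [ha.2, hb.2]), hj']
      · have h1 : (b : ℝ) ≤ j := by
          exact_mod_cast hbmin j (Finset.mem_filter.2 ⟨hj, hjt⟩)
        rw [abs_of_nonpos (by linarith), abs_of_nonpos (by linarith [ha.2, hb.2]),
          abs_of_nonpos (by linarith), hj']
        ring
    have hc := hk.2 (mem_Ici.2 (abs_nonneg ((a : ℝ) - j)))
      (mem_Ici.2 (abs_nonneg ((b : ℝ) - j))) hx hy hxy
    simp only [smul_eq_mul] at hc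
    rw [habs]
    nlinarith [mul_le_mul_of_nonneg_left hc (he j hj)]
  calc ∑ j ∈ A, e j * k |t - j|
      ≤ ∑ j ∈ A, (x * (e j * k |(a : ℝ) - j|) + y * (e j * k |(b : ℝ) - j|)) :=
        Finset.sum_le_sum hterm
    _ = x * ∑ j ∈ A, e j * k |(a : ℝ) - j| + y * ∑ j ∈ A, e j * k |(b : ℝ) - j| := by
        rw [Finset.sum_add_distrib, Finset.mul_sum, Finset.mul_sum]
    _ ≤ x * D + y * D := by gcongr <;> [exact hD a ha.1; exact hD b hb.1]
    _ = D := by rw [← add_mul, hxy, one_mul]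

end MaximumPrinciple

section LineReduction

variable {lam dd : V → V → ℝ} {P : V → Measure (ℕ → V)} {α ν c₃ C₃ : ℝ}

lemma equi_nonneg (h : Standing lam dd P α ν c₃ C₃) (K : Set V) (x : V) : 0 ≤ equi lam P K x := by
  unfold equi
  split_ifs
  · exact mul_nonneg (h.lamTot_pos x).le ENNReal.toReal_nonneg
  · exact le_rfl

lemma capa_coe_finset (K : Finset V) : capa lam P K = ∑ y ∈ K, equi lam P K y :=
  K.tsum_subtype' fun y => equi lam P K y

/-- Lower bound on the Green function in terms of a shifted one-dimensional Riesz kernel. -/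
lemma Standing.exists_shift_le_green (h : Standing lam dd P α ν c₃ C₃) {η δ : ℝ}
    (hη : η ∈ Ioo (0 : ℝ) 1) (hδ : δ ∈ Ioo (0 : ℝ) 1) :
    ∃ c : ℝ, 0 < c ∧ ∀ (r n : ℝ) (x y : V), 1 ≤ r → 0 ≤ n → δ * n - 1 / δ ≤ dd x y →
      dd x y ≤ (n + 1 / δ) * r → (1 - η) * c₃ * (r ^ (-ν) * (n + c) ^ (-ν)) ≤ green lam P x y := by
  obtain ⟨hη0, hη1⟩ := hη
  obtain ⟨hδ0, hδ1⟩ := hδ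
  have hν := h.nu_pos
  have hc₃ := h.c₃_pos
  obtain ⟨M, hM⟩ := h.greenAsymp η hη0
  obtain ⟨c₂, C₂, hc₂, -, hdiag, hoff⟩ := h.greenBounds
  have hδi : 1 ≤ 1 / δ := by rw [le_div_iff₀ hδ0]; linarith
  set L := (|M| + 1 + 1 / δ) / δ with hL
  have hL0 : 0 ≤ L := by positivity
  set Q := max 1 ((c₃ / c₂) ^ ν⁻¹) with hQ
  have hQ1 : 1 ≤ Q := le_max_left _ _
  have hQ0 : 0 < Q := by linarith
  have hQν : c₃ * Q ^ (-ν) ≤ c₂ := by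
    have h1 : c₃ / c₂ ≤ Q ^ ν := by
      calc c₃ / c₂ = ((c₃ / c₂) ^ ν⁻¹) ^ ν := by
            rw [← Real.rpow_mul (by positivity), inv_mul_cancel₀ hν.ne', Real.rpow_one]
        _ ≤ Q ^ ν := by gcongr; exact le_max_right _ _
    rw [div_le_iff₀ hc₂] at h1
    rw [Real.rpow_neg hQ0.le, ← div_eq_mul_inv, div_le_iff₀ (by positivity)]
    linarith
  have hLδ : 1 ≤ L + 1 / δ := by linarith
  refine ⟨(L + 1 / δ) * Q, by positivity, fun r n x y hr hn hlow hup => ?_⟩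
  have hr0 : 0 < r := by linarith
  set c := (L + 1 / δ) * Q with hc
  have hcL : L + 1 / δ ≤ c := by nlinarith
  have hcpos : 0 < c := by positivity
  have hη' : 0 ≤ (1 - η) * c₃ := mul_nonneg (by linarith) hc₃.le
  rw [← Real.mul_rpow hr0.le (by positivity)]
  rcases le_or_gt L n with hLn | hLn
  · have h1 : |M| + 1 ≤ dd x y := by
      have : |M| + 1 + 1 / δ ≤ δ * n := by
        rw [hL, div_le_iff₀ hδ0] at hLn; linarith
      linarith
    have hd0 : 0 < dd x y := by linarith [abs_nonneg M]
    have h2 := (hM x y (by linarith [le_abs_self M])).1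
    calc (1 - η) * c₃ * (r * (n + c)) ^ (-ν) ≤ (1 - η) * c₃ * dd x y ^ (-ν) := by
          refine mul_le_mul_of_nonneg_left (Real.rpow_le_rpow_of_nonpos hd0 ?_ (by linarith)) hη'
          nlinarith
      _ ≤ green lam P x y := by
          rw [Real.rpow_neg hd0.le, ← div_eq_mul_inv, div_le_iff₀ (by positivity)]
          exact h2
  · have h1 : (1 - η) * c₃ * (r * (n + c)) ^ (-ν) ≤ c₂ * ((L + 1 / δ) * r) ^ (-ν) := by
      calc (1 - η) * c₃ * (r * (n + c)) ^ (-ν) ≤ c₃ * (r * c) ^ (-ν) := by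
            gcongr ?_ * ?_
            · nlinarith
            · exact Real.rpow_le_rpow_of_nonpos (by positivity) (by gcongr; linarith) (by linarith)
        _ = c₃ * Q ^ (-ν) * ((L + 1 / δ) * r) ^ (-ν) := by
            rw [mul_assoc, ← Real.mul_rpow hQ0.le (by positivity)]
            congr 2; rw [hc]; ring
        _ ≤ c₂ * ((L + 1 / δ) * r) ^ (-ν) := by gcongr
    refine h1.trans ?_
    by_cases hxy : x = y
    · subst hxy
      refine le_trans ?_ (hdiag x).1
      exact mul_le_of_le_one_right hc₂.le
        (Real.rpow_le_one_of_one_le_of_nonpos (by nlinarith) (by linarith))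
    · refine le_trans ?_ (hoff x y hxy).1
      refine mul_le_mul_of_nonneg_left (Real.rpow_le_rpow_of_nonpos (h.dd_pos x y hxy) ?_
        (by linarith)) hc₂.le
      exact hup.trans (by gcongr)

/-- Projecting the equilibrium measure of a union of spread-out sets to the index line gives a
charge of total mass the capacity, whose one-dimensional potential is bounded. -/
lemma Standing.exists_line_charge (h : Standing lam dd P α ν c₃ C₃) {η δ : ℝ}
    (hη : η ∈ Ioo (0 : ℝ) 1) (hδ : δ ∈ Ioo (0 : ℝ) 1) :
    ∃ c : ℝ, 0 < c ∧ ∀ (r : ℝ) (A : Finset ℕ) (S : ℕ → Set V), 1 ≤ r → A.Nonempty →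
      (∀ i ∈ A, (S i).Finite ∧ (S i).Nonempty) →
      (∀ i ∈ A, ∀ j ∈ A, ∀ y ∈ S i, ∀ z ∈ S j,
        δ * |(i : ℝ) - (j : ℝ)| - 1 / δ ≤ dd y z ∧
        dd y z ≤ (|(i : ℝ) - (j : ℝ)| + 1 / δ) * r) →
      ∃ e : ℕ → ℝ, (∀ j, 0 ≤ e j) ∧ capa lam P (⋃ i ∈ A, S i) = ∑ j ∈ A, e j ∧
        ∀ t : ℝ, ∑ j ∈ A, e j * (|t - j| + c) ^ (-ν) ≤ r ^ ν / ((1 - η) * c₃) := by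
  obtain ⟨c, hc, hg⟩ := h.exists_shift_le_green hη hδ
  refine ⟨c, hc, fun r A S hr hA hS hd => ?_⟩
  have hr0 : 0 < r := by linarith
  have hη' : 0 < (1 - η) * c₃ := mul_pos (by linarith [hη.2]) h.c₃_pos
  obtain ⟨K, hK⟩ : ∃ K : Finset V, (K : Set V) = ⋃ i ∈ A, S i :=
    (A.finite_toSet.biUnion fun i hi => (hS i hi).1).exists_finset_coe
  have hidx : ∀ y : V, ∃ i, y ∈ K → i ∈ A ∧ y ∈ S i := by
    intro y
    by_cases hy : y ∈ K
    · have : y ∈ ⋃ i ∈ A, S i := hK ▸ hy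
      simp only [mem_iUnion] at this
      obtain ⟨i, hi, hyi⟩ := this
      exact ⟨i, fun _ => ⟨hi, hyi⟩⟩
    · exact ⟨0, fun h => absurd h hy⟩
  choose idx hidx using hidx
  set e : ℕ → ℝ := fun j => ∑ y ∈ K with idx y = j, equi lam P K y with he
  have he0 : ∀ j, 0 ≤ e j := fun j => Finset.sum_nonneg fun y _ => equi_nonneg h _ y
  refine ⟨e, he0, ?_, sum_kernel_le_of_forall_mem hA (fun j _ => he0 j)
    (convexOn_rpow_neg_add h.nu_pos hc) (antitoneOn_rpow_neg_add h.nu_pos hc) fun i hi => ?_⟩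
  · rw [← hK, capa_coe_finset]
    exact (Finset.sum_fiberwise_of_maps_to (fun y hy => (hidx y hy).1) _).symm
  · obtain ⟨x, hx⟩ := (hS i hi).2
    have key : (1 - η) * c₃ * r ^ (-ν) * ∑ j ∈ A, e j * (|(i : ℝ) - j| + c) ^ (-ν) ≤ 1 := by
      refine le_trans ?_ (h.sum_green_mul_equi_le_one K x)
      rw [← Finset.sum_fiberwise_of_maps_to (fun y hy => (hidx y hy).1)
        (fun y => green lam P x y * equi lam P K y), Finset.mul_sum]
      refine Finset.sum_le_sum fun j hj => ?_
      rw [he, Finset.sum_mul, Finset.mul_sum]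
      refine Finset.sum_le_sum fun y hy => ?_
      rw [Finset.mem_filter] at hy
      have hyS := (hidx y hy.1).2
      rw [hy.2] at hyS
      have h1 := hd i hi j hj x hx y hyS
      have h2 := hg r |(i : ℝ) - j| x y hr (abs_nonneg _) h1.1 h1.2
      nlinarith [mul_le_mul_of_nonneg_right h2 (equi_nonneg h K y)]
    rw [Real.rpow_neg hr0.le] at key
    rw [le_div_iff₀ hη']
    have hrν : 0 < r ^ ν := by positivity
    field_simp at key
    linarith

end LineReduction

section RieszKernel

open ProbabilityTheory

lemma lintegral_beta {p q : ℝ} (hp : 0 < p) (hq : 0 < q) :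
    ∫⁻ x in Ioo (0 : ℝ) 1, ENNReal.ofReal (x ^ (p - 1) * (1 - x) ^ (q - 1)) =
      ENNReal.ofReal (beta p q) := by
  have hβ := beta_pos hp hq
  have h := lintegral_betaPDF_eq_one hp hq
  simp_rw [lintegral_betaPDF, mul_assoc, ENNReal.ofReal_mul (one_div_pos.2 hβ).le] at h
  rw [lintegral_const_mul' _ _ ENNReal.ofReal_ne_top, one_div, ENNReal.ofReal_inv_of_pos hβ] at h
  rw [ENNReal.eq_inv_of_mul_eq_one_left ((mul_comm _ _).trans h), inv_inv]

lemma lintegral_beta_Ioo {p q : ℝ} (hp : 0 < p) (hq : 0 < q) {r t : ℝ} (hrt : r < t) :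
    ∫⁻ s in Ioo r t, ENNReal.ofReal ((s - r) ^ (p - 1) * (t - s) ^ (q - 1)) =
      ENNReal.ofReal ((t - r) ^ (p + q - 1) * beta p q) := by
  have hd : 0 < t - r := sub_pos.2 hrt
  have himg : (fun u => (t - r) * u + r) '' Ioo 0 1 = Ioo r t := by
    rw [image_affine_Ioo hd]; simp
  rw [← himg, lintegral_image_eq_lintegral_abs_deriv_mul (f' := fun _ => t - r) measurableSet_Ioo
    (fun x _ => by
      simpa using (((hasDerivAt_id x).const_mul (t - r)).add_const r).hasDerivWithinAt)
    (fun x _ y _ hxy => by simpa [hd.ne'] using hxy),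
    ENNReal.ofReal_mul (by positivity), ← lintegral_beta hp hq,
    ← lintegral_const_mul' _ _ ENNReal.ofReal_ne_top]
  refine setLIntegral_congr_fun measurableSet_Ioo fun u hu => ?_
  have hu1 : 0 < 1 - u := sub_pos.2 hu.2
  have e1 : (t - r) * u + r - r = (t - r) * u := by ring
  have e2 : t - ((t - r) * u + r) = (t - r) * (1 - u) := by ring
  simp only [e1, e2]
  rw [← ENNReal.ofReal_mul (abs_nonneg _), ← ENNReal.ofReal_mul (by positivity), abs_of_pos hd,
    Real.mul_rpow hd.le hu.1.le, Real.mul_rpow hd.le hu1.le]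
  congr 1
  rw [show p + q - 1 = 1 + (p - 1) + (q - 1) by ring, Real.rpow_add hd, Real.rpow_add hd,
    Real.rpow_one]
  ring

/-- Factorization of the Riesz kernel `|t - s| ^ (-ν)` through one-sided kernels. -/
lemma lintegral_copson {ν : ℝ} (h0 : 0 < ν) (h1 : ν < 1) {s t : ℝ} (hs : 0 < s) (hst : s < t) :
    ∫⁻ r in Ioo 0 s, ENNReal.ofReal
        (r ^ (ν - 1) * (s - r) ^ (-((1 + ν) / 2)) * (t - r) ^ (-((1 + ν) / 2))) =
      ENNReal.ofReal (beta ν ((1 - ν) / 2) * ((s * t) ^ ((ν - 1) / 2) * (t - s) ^ (-ν))) := by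
  have ht : 0 < t := hs.trans hst
  have hd : 0 < t - s := sub_pos.2 hst
  have himg : (fun r => (t - s) * r / (s * (t - r))) '' Ioo 0 s = Ioo 0 1 := by
    ext u
    constructor
    · rintro ⟨r, ⟨hr0, hrs⟩, rfl⟩
      have : 0 < t - r := by linarith
      refine ⟨by positivity, ?_⟩
      rw [div_lt_one (by positivity)]
      nlinarith
    · rintro ⟨hu0, hu1⟩
      have hden : 0 < (t - s) + s * u := by positivity
      refine ⟨s * t * u / ((t - s) + s * u), ⟨by positivity, ?_⟩, ?_⟩
      · rw [div_lt_iff₀ hden]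
        nlinarith [mul_pos hs hd]
      · have : t - s * t * u / ((t - s) + s * u) = t * (t - s) / ((t - s) + s * u) := by
          field_simp; ring
        simp only [this]
        field_simp
  have hder : ∀ r ∈ Ioo 0 s, HasDerivWithinAt (fun r => (t - s) * r / (s * (t - r)))
      ((t - s) * t / (s * (t - r) ^ 2)) (Ioo 0 s) r := by
    intro r hr
    have htr : t - r ≠ 0 := by linarith [hr.2]
    have := ((hasDerivAt_id r).const_mul (t - s)).div
      (((hasDerivAt_id r).const_sub t).const_mul s) (mul_ne_zero hs.ne' htr)
    refine (this.congr_deriv ?_).hasDerivWithinAt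
    simp only [id]
    field_simp
    ring
  have hinj : InjOn (fun r => (t - s) * r / (s * (t - r))) (Ioo 0 s) := by
    intro x hx y hy hxy
    have hx' : 0 < t - x := by linarith [hx.2]
    have hy' : 0 < t - y := by linarith [hy.2]
    simp only at hxy
    rw [div_eq_div_iff (by positivity) (by positivity)] at hxy
    have : (t - s) * s * t * (x - y) = 0 := by linear_combination hxy
    have h3 : (t - s) * s * t ≠ 0 := by positivity
    linarith [(mul_eq_zero.1 this).resolve_left h3]
  have hbeta := lintegral_beta (p := ν) (q := (1 - ν) / 2) h0 (by linarith)
  rw [← himg, lintegral_image_eq_lintegral_abs_deriv_mul measurableSet_Ioo hder hinj] at hbeta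
  rw [mul_comm (beta _ _), ENNReal.ofReal_mul (by positivity), ← hbeta,
    ← lintegral_const_mul' _ _ ENNReal.ofReal_ne_top]
  refine setLIntegral_congr_fun measurableSet_Ioo fun r hr => ?_
  have hr0 : 0 < r := hr.1
  have hsr : 0 < s - r := sub_pos.2 hr.2
  have htr : 0 < t - r := by linarith
  have e1 : 1 - (t - s) * r / (s * (t - r)) = t * (s - r) / (s * (t - r)) := by
    field_simp; ring
  simp only [e1]
  rw [← ENNReal.ofReal_mul (abs_nonneg _), ← ENNReal.ofReal_mul (by positivity),
    abs_of_pos (by positivity)]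
  congr 1
  refine Real.log_injOn_pos (mem_Ioi.2 (by positivity)) (mem_Ioi.2 (by positivity)) ?_
  simp (disch := positivity) only [Real.log_mul, Real.log_div, Real.log_rpow, Real.log_pow]
  push_cast
  ring

/-- The arcsine-type density `(s (1 - s)) ^ ((ν - 1) / 2)` has constant Riesz potential on
`[0, 1]`. -/
lemma lintegral_riesz {ν : ℝ} (h0 : 0 < ν) (h1 : ν < 1) {t : ℝ} (ht : t ∈ Icc (0 : ℝ) 1) :
    ∫⁻ s in Ioo (0 : ℝ) 1, ENNReal.ofReal
        ((s ^ ((ν - 1) / 2) * (1 - s) ^ ((ν - 1) / 2)) * |s - t| ^ (-ν)) =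
      ENNReal.ofReal (beta ((1 - ν) / 2) ((1 + ν) / 2)) := by
  have hb0 : 0 < (1 - ν) / 2 := by linarith
  have hb1 : 0 < (1 + ν) / 2 := by linarith
  rcases ht.1.eq_or_lt with rfl | ht0
  · rw [← lintegral_beta hb0 hb1]
    refine setLIntegral_congr_fun measurableSet_Ioo fun s hs => ?_
    simp only [sub_zero, abs_of_pos hs.1]
    rw [mul_right_comm, ← Real.rpow_add hs.1]
    ring_nf
  set G : ℝ → ℝ → ℝ≥0∞ := fun s r => if r < s then ENNReal.ofReal
    ((1 - s) ^ ((ν - 1) / 2) * t ^ ((1 - ν) / 2) *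
      (r ^ (ν - 1) * (s - r) ^ (-((1 + ν) / 2)) * (t - r) ^ (-((1 + ν) / 2)))) else 0 with hG
  have hGm : Measurable (Function.uncurry G) :=
    Measurable.ite (measurableSet_lt measurable_snd measurable_fst) (by fun_prop) measurable_const
  have hβ := beta_pos h0 hb0
  have hL : ∫⁻ s in Ioo (0 : ℝ) 1, ∫⁻ r in Ioo 0 t, G s r =
      ENNReal.ofReal (beta ν ((1 - ν) / 2)) * ∫⁻ s in Ioo (0 : ℝ) 1, ENNReal.ofReal
        ((s ^ ((ν - 1) / 2) * (1 - s) ^ ((ν - 1) / 2)) * |s - t| ^ (-ν)) := by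
    rw [← lintegral_const_mul' _ _ ENNReal.ofReal_ne_top]
    refine setLIntegral_congr_fun_ae measurableSet_Ioo ?_
    have hne : ∀ᵐ s : ℝ, s ≠ t := by simp [ae_iff]
    filter_upwards [hne] with s hst hs
    have hs1 : 0 < 1 - s := sub_pos.2 hs.2
    have e1 : ∫⁻ r in Ioo 0 t, G s r = ∫⁻ r in Ioo 0 (min s t), ENNReal.ofReal
        ((1 - s) ^ ((ν - 1) / 2) * t ^ ((1 - ν) / 2) *
          (r ^ (ν - 1) * (s - r) ^ (-((1 + ν) / 2)) * (t - r) ^ (-((1 + ν) / 2)))) := by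
      have : G s = (Iio s).indicator fun r => ENNReal.ofReal
        ((1 - s) ^ ((ν - 1) / 2) * t ^ ((1 - ν) / 2) *
          (r ^ (ν - 1) * (s - r) ^ (-((1 + ν) / 2)) * (t - r) ^ (-((1 + ν) / 2)))) := by
        ext r; simp [hG, indicator]
      rw [this, lintegral_indicator measurableSet_Iio, Measure.restrict_restrict measurableSet_Iio,
        inter_comm, Ioo_inter_Iio, min_comm]
    have hc0 : 0 ≤ (1 - s) ^ ((ν - 1) / 2) * t ^ ((1 - ν) / 2) := by positivity
    simp_rw [ENNReal.ofReal_mul hc0] at e1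
    rw [lintegral_const_mul' _ _ ENNReal.ofReal_ne_top] at e1
    rw [e1, ← ENNReal.ofReal_mul hβ.le]
    have e2 : t ^ ((1 - ν) / 2) * t ^ ((ν - 1) / 2) = 1 := by
      rw [← Real.rpow_add ht0, show (1 - ν) / 2 + (ν - 1) / 2 = 0 by ring, Real.rpow_zero]
    rcases lt_or_gt_of_ne hst with hlt | hlt
    · rw [min_eq_left hlt.le, lintegral_copson h0 h1 hs.1 hlt, ← ENNReal.ofReal_mul hc0,
        abs_sub_comm, abs_of_pos (sub_pos.2 hlt), Real.mul_rpow hs.1.le ht0.le]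
      congr 1
      linear_combination ((1 - s) ^ ((ν - 1) / 2) * beta ν ((1 - ν) / 2) * s ^ ((ν - 1) / 2) *
        (t - s) ^ (-ν)) * e2
    · have := lintegral_copson h0 h1 ht0 hlt
      simp_rw [mul_right_comm _ ((t - _) ^ (-((1 + ν) / 2)))] at this
      rw [min_eq_right hlt.le, this, ← ENNReal.ofReal_mul hc0,
        abs_of_pos (sub_pos.2 hlt), Real.mul_rpow ht0.le hs.1.le]
      congr 1
      linear_combination ((1 - s) ^ ((ν - 1) / 2) * beta ν ((1 - ν) / 2) * s ^ ((ν - 1) / 2) *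
        (s - t) ^ (-ν)) * e2
  have hR : ∫⁻ r in Ioo 0 t, ∫⁻ s in Ioo (0 : ℝ) 1, G s r =
      ENNReal.ofReal (beta ν ((1 - ν) / 2)) *
        ENNReal.ofReal (beta ((1 - ν) / 2) ((1 + ν) / 2)) := by
    have e1 : ∀ r ∈ Ioo 0 t, ∫⁻ s in Ioo (0 : ℝ) 1, G s r =
        ENNReal.ofReal (t ^ ((1 - ν) / 2)) * ENNReal.ofReal (beta ((1 - ν) / 2) ((1 + ν) / 2)) *
        ENNReal.ofReal ((r - 0) ^ (ν - 1) * (t - r) ^ ((1 - ν) / 2 - 1)) := by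
      intro r hr
      have hr0 := hr.1
      have htr : 0 < t - r := sub_pos.2 hr.2
      have hr1 : r < 1 := hr.2.trans_le ht.2
      have e2 : ∫⁻ s in Ioo (0 : ℝ) 1, G s r = ∫⁻ s in Ioo r 1,
          ENNReal.ofReal (t ^ ((1 - ν) / 2) * (r ^ (ν - 1) * (t - r) ^ ((1 - ν) / 2 - 1))) *
          ENNReal.ofReal ((s - r) ^ ((1 - ν) / 2 - 1) * (1 - s) ^ ((1 + ν) / 2 - 1)) := by
        have : (fun s => G s r) = (Ioi r).indicator fun s =>
          ENNReal.ofReal (t ^ ((1 - ν) / 2) * (r ^ (ν - 1) * (t - r) ^ ((1 - ν) / 2 - 1))) *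
          ENNReal.ofReal ((s - r) ^ ((1 - ν) / 2 - 1) * (1 - s) ^ ((1 + ν) / 2 - 1)) := by
          ext s
          simp only [hG, indicator, mem_Ioi]
          split_ifs
          · rw [← ENNReal.ofReal_mul (by positivity)]
            congr 1
            rw [show (1 - ν) / 2 - 1 = -((1 + ν) / 2) by ring,
              show (1 + ν) / 2 - 1 = (ν - 1) / 2 by ring]
            ring
          · rfl
        rw [this, lintegral_indicator measurableSet_Ioi,
          Measure.restrict_restrict measurableSet_Ioi, inter_comm, Ioo_inter_Ioi, max_eq_right hr0.le]
      rw [e2, lintegral_const_mul' _ _ ENNReal.ofReal_ne_top, lintegral_beta_Ioo hb0 hb1 hr1,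
        show (1 - ν) / 2 + (1 + ν) / 2 - 1 = 0 by ring, Real.rpow_zero, one_mul,
        ENNReal.ofReal_mul (by positivity), sub_zero]
      ring
    rw [setLIntegral_congr_fun measurableSet_Ioo e1, lintegral_const_mul' _ _
      (ENNReal.mul_ne_top ENNReal.ofReal_ne_top ENNReal.ofReal_ne_top),
      lintegral_beta_Ioo h0 hb0 ht0, sub_zero, ENNReal.ofReal_mul (by positivity)]
    have e3 : ENNReal.ofReal (t ^ ((1 - ν) / 2)) *
        ENNReal.ofReal (t ^ (ν + (1 - ν) / 2 - 1)) = 1 := by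
      rw [← ENNReal.ofReal_mul (by positivity), ← Real.rpow_add ht0,
        show (1 - ν) / 2 + (ν + (1 - ν) / 2 - 1) = 0 by ring, Real.rpow_zero, ENNReal.ofReal_one]
    rw [mul_right_comm, ← mul_assoc, e3, one_mul]
  have hswap := lintegral_lintegral_swap (μ := volume.restrict (Ioo (0 : ℝ) 1))
    (ν := volume.restrict (Ioo 0 t)) hGm.aemeasurable
  rw [hL, hR] at hswap
  exact (ENNReal.mul_right_inj (ENNReal.ofReal_pos.2 hβ).ne' ENNReal.ofReal_ne_top).1 hswap

end RieszKernel

section LineCharge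

open ProbabilityTheory

lemma integrableOn_arcsine {ν : ℝ} (h0 : 0 < ν) :
    IntegrableOn (fun s : ℝ => s ^ ((ν - 1) / 2) * (1 - s) ^ ((ν - 1) / 2)) (Ioo 0 1) ∧
    ∫ s in Ioo (0 : ℝ) 1, s ^ ((ν - 1) / 2) * (1 - s) ^ ((ν - 1) / 2) =
      beta ((1 + ν) / 2) ((1 + ν) / 2) := by
  have hb : 0 < (1 + ν) / 2 := by linarith
  have h := lintegral_beta hb hb
  rw [show (1 + ν) / 2 - 1 = (ν - 1) / 2 by ring] at h
  have hm : AEStronglyMeasurable (fun s : ℝ => s ^ ((ν - 1) / 2) * (1 - s) ^ ((ν - 1) / 2))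
      (volume.restrict (Ioo 0 1)) := by
    have : Measurable fun s : ℝ => s ^ ((ν - 1) / 2) * (1 - s) ^ ((ν - 1) / 2) := by fun_prop
    exact this.aestronglyMeasurable
  have hnn : 0 ≤ᵐ[volume.restrict (Ioo (0 : ℝ) 1)]
      fun s : ℝ => s ^ ((ν - 1) / 2) * (1 - s) ^ ((ν - 1) / 2) := by
    filter_upwards [ae_restrict_mem measurableSet_Ioo] with s hs
    exact mul_nonneg (Real.rpow_nonneg hs.1.le _) (Real.rpow_nonneg (sub_nonneg.2 hs.2.le) _)
  refine ⟨(lintegral_ofReal_ne_top_iff_integrable hm hnn).1 (h ▸ ENNReal.ofReal_ne_top), ?_⟩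
  rw [integral_eq_lintegral_of_nonneg_ae hnn hm, h, ENNReal.toReal_ofReal (beta_pos hb hb).le]

lemma integrableOn_riesz {ν : ℝ} (h0 : 0 < ν) (h1 : ν < 1) {t : ℝ} (ht : t ∈ Icc (0 : ℝ) 1) :
    IntegrableOn (fun s : ℝ => (s ^ ((ν - 1) / 2) * (1 - s) ^ ((ν - 1) / 2)) * |s - t| ^ (-ν))
      (Ioo 0 1) ∧
    ∫ s in Ioo (0 : ℝ) 1, (s ^ ((ν - 1) / 2) * (1 - s) ^ ((ν - 1) / 2)) * |s - t| ^ (-ν) =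
      beta ((1 - ν) / 2) ((1 + ν) / 2) := by
  have h := lintegral_riesz h0 h1 ht
  have hm : AEStronglyMeasurable
      (fun s : ℝ => (s ^ ((ν - 1) / 2) * (1 - s) ^ ((ν - 1) / 2)) * |s - t| ^ (-ν))
      (volume.restrict (Ioo 0 1)) := by
    have : Measurable fun s : ℝ =>
      (s ^ ((ν - 1) / 2) * (1 - s) ^ ((ν - 1) / 2)) * |s - t| ^ (-ν) := by fun_prop
    exact this.aestronglyMeasurable
  have hnn : 0 ≤ᵐ[volume.restrict (Ioo (0 : ℝ) 1)]
      fun s : ℝ => (s ^ ((ν - 1) / 2) * (1 - s) ^ ((ν - 1) / 2)) * |s - t| ^ (-ν) := by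
    filter_upwards [ae_restrict_mem measurableSet_Ioo] with s hs
    exact mul_nonneg (mul_nonneg (Real.rpow_nonneg hs.1.le _)
      (Real.rpow_nonneg (sub_nonneg.2 hs.2.le) _)) (Real.rpow_nonneg (abs_nonneg _) _)
  refine ⟨(lintegral_ofReal_ne_top_iff_integrable hm hnn).1 (h ▸ ENNReal.ofReal_ne_top), ?_⟩
  rw [integral_eq_lintegral_of_nonneg_ae hnn hm, h,
    ENNReal.toReal_ofReal (beta_pos (by linarith) (by linarith)).le]

lemma shifted_kernel_nonneg {ν ε : ℝ} (hε : 0 < ε) (x : ℝ) : 0 ≤ (|x| + ε) ^ (-ν) :=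
  Real.rpow_nonneg (by positivity) _

lemma shifted_kernel_le {ν ε : ℝ} (h0 : 0 < ν) (hε : 0 < ε) (x : ℝ) :
    (|x| + ε) ^ (-ν) ≤ ε ^ (-ν) :=
  Real.rpow_le_rpow_of_nonpos hε (by linarith [abs_nonneg x]) (by linarith)

lemma integrableOn_shifted_riesz {ν ε : ℝ} (h0 : 0 < ν) (hε : 0 < ε) (t : ℝ) :
    IntegrableOn (fun s : ℝ =>
      (s ^ ((ν - 1) / 2) * (1 - s) ^ ((ν - 1) / 2)) * (|s - t| + ε) ^ (-ν)) (Ioo 0 1) := by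
  refine (integrableOn_arcsine h0).1.mul_bdd (c := ε ^ (-ν)) ?_ (ae_of_all _ fun s => ?_)
  · have : Measurable fun s : ℝ => (|s - t| + ε) ^ (-ν) := by fun_prop
    exact this.aestronglyMeasurable
  · rw [Real.norm_of_nonneg (shifted_kernel_nonneg hε _)]
    exact shifted_kernel_le h0 hε _

/-- Uniform convergence of the regularized potentials of the arcsine-type density. -/
lemma exists_le_shifted_riesz {ν θ : ℝ} (h0 : 0 < ν) (h1 : ν < 1) (hθ : 0 < θ) :
    ∃ ε₀ : ℝ, 0 < ε₀ ∧ ∀ ε : ℝ, 0 < ε → ε ≤ ε₀ → ∀ t ∈ Icc (0 : ℝ) 1,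
      (1 - θ) * beta ((1 - ν) / 2) ((1 + ν) / 2) ≤ ∫ s in Ioo (0 : ℝ) 1,
        (s ^ ((ν - 1) / 2) * (1 - s) ^ ((ν - 1) / 2)) * (|s - t| + ε) ^ (-ν) := by
  set B := beta ((1 - ν) / 2) ((1 + ν) / 2) with hB
  have hBpos : 0 < B := beta_pos (by linarith) (by linarith)
  have hw : ∀ s ∈ Ioo (0 : ℝ) 1, 0 ≤ s ^ ((ν - 1) / 2) * (1 - s) ^ ((ν - 1) / 2) := fun s hs =>
    mul_nonneg (Real.rpow_nonneg hs.1.le _) (Real.rpow_nonneg (sub_nonneg.2 hs.2.le) _)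
  have hmono : ∀ ε ε' : ℝ, 0 < ε → ε ≤ ε' → ∀ t,
      ∫ s in Ioo (0 : ℝ) 1, (s ^ ((ν - 1) / 2) * (1 - s) ^ ((ν - 1) / 2)) * (|s - t| + ε') ^ (-ν) ≤
      ∫ s in Ioo (0 : ℝ) 1, (s ^ ((ν - 1) / 2) * (1 - s) ^ ((ν - 1) / 2)) * (|s - t| + ε) ^ (-ν) :=
    fun ε ε' hε hεε' t => setIntegral_mono_on (integrableOn_shifted_riesz h0 (hε.trans_le hεε') t)
      (integrableOn_shifted_riesz h0 hε t) measurableSet_Ioo fun s hs =>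
      mul_le_mul_of_nonneg_left (Real.rpow_le_rpow_of_nonpos (by positivity) (by linarith)
        (by linarith)) (hw s hs)
  set F : ℕ → ℝ → ℝ := fun n t => ∫ s in Ioo (0 : ℝ) 1,
    (s ^ ((ν - 1) / 2) * (1 - s) ^ ((ν - 1) / 2)) * (|s - t| + 1 / ((n : ℝ) + 1)) ^ (-ν) with hF
  have hpos : ∀ n : ℕ, (0 : ℝ) < 1 / ((n : ℝ) + 1) := fun n => Nat.one_div_pos_of_nat
  have hcont : ∀ n, Continuous (F n) := by
    intro n
    refine continuous_of_dominated (bound := fun s =>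
      (s ^ ((ν - 1) / 2) * (1 - s) ^ ((ν - 1) / 2)) * (1 / ((n : ℝ) + 1)) ^ (-ν))
      (fun t => (integrableOn_shifted_riesz h0 (hpos n) t).aestronglyMeasurable) (fun t => ?_)
      ((integrableOn_arcsine h0).1.mul_const _) (ae_of_all _ fun s => ?_)
    · filter_upwards [ae_restrict_mem measurableSet_Ioo] with s hs
      rw [Real.norm_of_nonneg (mul_nonneg (hw s hs) (shifted_kernel_nonneg (hpos n) _))]
      exact mul_le_mul_of_nonneg_left (shifted_kernel_le h0 (hpos n) _) (hw s hs)
    · refine continuous_const.mul (Continuous.rpow_const (by fun_prop) fun t => Or.inl ?_)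
      have := hpos n
      positivity
  have hlim : ∀ t ∈ Icc (0 : ℝ) 1, Tendsto (F · t) atTop (𝓝 B) := by
    intro t ht
    have hI := integrableOn_riesz h0 h1 ht
    rw [hB, ← hI.2]
    have hne : ∀ᵐ s ∂(volume.restrict (Ioo (0 : ℝ) 1)), s ≠ t :=
      ae_restrict_of_ae (by simp [ae_iff])
    refine tendsto_integral_of_dominated_convergence _
      (fun n => (integrableOn_shifted_riesz h0 (hpos n) t).aestronglyMeasurable) hI.1
      (fun n => ?_) ?_
    · filter_upwards [ae_restrict_mem measurableSet_Ioo, hne] with s hs hst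
      rw [Real.norm_of_nonneg (mul_nonneg (hw s hs) (shifted_kernel_nonneg (hpos n) _))]
      have : 0 < |s - t| := abs_pos.2 (sub_ne_zero.2 hst)
      exact mul_le_mul_of_nonneg_left (Real.rpow_le_rpow_of_nonpos this
        (by linarith [hpos n]) (by linarith)) (hw s hs)
    · filter_upwards [hne] with s hst
      have : 0 < |s - t| := abs_pos.2 (sub_ne_zero.2 hst)
      refine Tendsto.const_mul _ (Tendsto.rpow_const ?_ (Or.inl this.ne'))
      simpa using tendsto_one_div_add_atTop_nhds_zero_nat.const_add |s - t|
  have hunif := Monotone.tendstoUniformlyOn_of_forall_tendsto (F := F) (f := fun _ => B)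
    (isCompact_Icc (a := (0 : ℝ)) (b := 1)) (fun n => (hcont n).continuousOn)
    (fun t _ n m hnm => hmono _ _ (hpos m)
      (one_div_le_one_div_of_le (by positivity) (by gcongr)) t)
    continuousOn_const hlim
  obtain ⟨n, hn⟩ := (Metric.tendstoUniformlyOn_iff.1 hunif (θ * B) (by positivity)).exists
  refine ⟨1 / ((n : ℝ) + 1), hpos n, fun ε hε hεn t ht => ?_⟩
  refine le_trans ?_ (hmono ε _ hε hεn t)
  have h3 := hn t ht
  rw [Real.dist_eq, abs_lt] at h3
  have : F n t = ∫ s in Ioo (0 : ℝ) 1,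
    (s ^ ((ν - 1) / 2) * (1 - s) ^ ((ν - 1) / 2)) * (|s - t| + 1 / ((n : ℝ) + 1)) ^ (-ν) := rfl
  rw [← this]
  linarith [h3.2]

lemma kappaNu_mul_beta {ν : ℝ} (h0 : 0 < ν) (h1 : ν < 1) :
    kappaNu ν * beta ((1 - ν) / 2) ((1 + ν) / 2) = beta ((1 + ν) / 2) ((1 + ν) / 2) := by
  have hcos : 0 < Real.cos (Real.pi * ν / 2) :=
    Real.cos_pos_of_mem_Ioo ⟨by nlinarith [Real.pi_pos], by nlinarith [Real.pi_pos]⟩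
  have hrefl := Real.Gamma_mul_Gamma_one_sub ((1 - ν) / 2)
  rw [show 1 - (1 - ν) / 2 = (1 + ν) / 2 by ring,
    show Real.pi * ((1 - ν) / 2) = Real.pi / 2 - Real.pi * ν / 2 by ring,
    Real.sin_pi_div_two_sub] at hrefl
  rw [kappaNu, if_pos h1, beta, beta, hrefl, show (1 - ν) / 2 + (1 + ν) / 2 = 1 by ring,
    show (1 + ν) / 2 + (1 + ν) / 2 = 1 + ν by ring, Real.Gamma_one]
  have := Real.pi_pos.ne'
  generalize Real.cos (Real.pi * ν / 2) = C at hcos ⊢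
  field_simp

/-- Bound on the total mass of a charge on `{1, …, p}` with bounded Riesz potential, `ν < 1`. -/
lemma exists_sum_charge_le_of_lt_one {ν c θ : ℝ} (h0 : 0 < ν) (h1 : ν < 1) (hc : 0 < c)
    (hθ : 0 < θ) :
    ∃ p₀ : ℝ, 0 < p₀ ∧ ∀ (p : ℕ) (A : Finset ℕ) (e : ℕ → ℝ) (D : ℝ), p₀ ≤ p →
      A ⊆ Finset.Icc 1 p → (∀ j, 0 ≤ e j) →
      (∀ t : ℝ, ∑ j ∈ A, e j * (|t - j| + c) ^ (-ν) ≤ D) →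
      (1 - θ) * ∑ j ∈ A, e j ≤ kappaNu ν * (p : ℝ) ^ ν * D := by
  obtain ⟨ε₀, hε₀, hε⟩ := exists_le_shifted_riesz h0 h1 hθ
  refine ⟨c / ε₀, by positivity, fun p A e D hp hA he hD => ?_⟩
  have hp0 : (0 : ℝ) < p := lt_of_lt_of_le (by positivity) hp
  have hcp : c / p ≤ ε₀ := by
    rw [div_le_iff₀ hε₀] at hp
    rw [div_le_iff₀ hp0]
    linarith
  set B := beta ((1 - ν) / 2) ((1 + ν) / 2) with hB
  have hBpos : 0 < B := beta_pos (by linarith) (by linarith)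
  have hscale : ∀ (s : ℝ) (j : ℕ), (|p * s - j| + c) ^ (-ν) =
      (p : ℝ) ^ (-ν) * (|s - j / p| + c / p) ^ (-ν) := by
    intro s j
    rw [← Real.mul_rpow hp0.le (by positivity)]
    congr 1
    rw [mul_add, mul_div_cancel₀ _ hp0.ne', ← abs_of_pos hp0, ← abs_mul, abs_of_pos hp0, mul_sub,
      mul_div_cancel₀ _ hp0.ne']
  have hint : ∀ j ∈ A, IntegrableOn (fun s : ℝ => e j * (p : ℝ) ^ (-ν) *
      ((s ^ ((ν - 1) / 2) * (1 - s) ^ ((ν - 1) / 2)) * (|s - j / p| + c / p) ^ (-ν)))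
      (Ioo 0 1) := fun j _ => (integrableOn_shifted_riesz h0 (by positivity) _).const_mul _
  have hupper : ∑ j ∈ A, e j * (p : ℝ) ^ (-ν) * ∫ s in Ioo (0 : ℝ) 1,
      (s ^ ((ν - 1) / 2) * (1 - s) ^ ((ν - 1) / 2)) * (|s - j / p| + c / p) ^ (-ν) ≤
      beta ((1 + ν) / 2) ((1 + ν) / 2) * D := by
    simp_rw [← integral_const_mul]
    rw [← integral_finsetSum _ hint, ← (integrableOn_arcsine h0).2, ← integral_mul_const]
    refine setIntegral_mono_on (integrable_finsetSum _ hint)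
      ((integrableOn_arcsine h0).1.mul_const _) measurableSet_Ioo fun s hs => ?_
    have hs1 : 0 < 1 - s := sub_pos.2 hs.2
    have hs0 := hs.1
    have hw : 0 ≤ s ^ ((ν - 1) / 2) * (1 - s) ^ ((ν - 1) / 2) := by positivity
    calc ∑ j ∈ A, e j * (p : ℝ) ^ (-ν) *
          ((s ^ ((ν - 1) / 2) * (1 - s) ^ ((ν - 1) / 2)) * (|s - j / p| + c / p) ^ (-ν))
        = (s ^ ((ν - 1) / 2) * (1 - s) ^ ((ν - 1) / 2)) *
          ∑ j ∈ A, e j * (|p * s - j| + c) ^ (-ν) := by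
          rw [Finset.mul_sum]
          refine Finset.sum_congr rfl fun j _ => ?_
          rw [hscale]
          ring
      _ ≤ _ := mul_le_mul_of_nonneg_left (hD _) hw
  have hlower : (∑ j ∈ A, e j) * ((p : ℝ) ^ (-ν) * ((1 - θ) * B)) ≤
      kappaNu ν * B * D := by
    rw [kappaNu_mul_beta h0 h1]
    refine le_trans ?_ hupper
    rw [Finset.sum_mul]
    refine Finset.sum_le_sum fun j hj => ?_
    rw [← mul_assoc]
    have hj' := Finset.mem_Icc.1 (hA hj)
    have hjp : (j : ℝ) / p ∈ Icc (0 : ℝ) 1 :=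
      ⟨by positivity, (div_le_one hp0).2 (by exact_mod_cast hj'.2)⟩
    exact mul_le_mul_of_nonneg_left (hε (c / p) (by positivity) hcp _ hjp)
      (mul_nonneg (he j) (by positivity))
  rw [Real.rpow_neg hp0.le] at hlower
  have hpν : 0 < (p : ℝ) ^ ν := by positivity
  have h2 : ((1 - θ) * ∑ j ∈ A, e j) * B ≤ (kappaNu ν * (p : ℝ) ^ ν * D) * B := by
    calc ((1 - θ) * ∑ j ∈ A, e j) * B
        = (p : ℝ) ^ ν * ((∑ j ∈ A, e j) * (((p : ℝ) ^ ν)⁻¹ * ((1 - θ) * B))) := by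
          field_simp
      _ ≤ (p : ℝ) ^ ν * (kappaNu ν * B * D) := mul_le_mul_of_nonneg_left hlower hpν.le
      _ = _ := by ring
  exact le_of_mul_le_mul_right h2 hBpos

lemma le_integral_inv_shifted_abs {c ℓ a b x : ℝ} (hc : 0 < c) (hℓ : 0 ≤ ℓ) (ha : a ≤ x - ℓ)
    (hb : x + ℓ ≤ b) :
    2 * Real.log ((ℓ + c) / c) ≤ ∫ t in a..b, (|t - x| + c) ^ (-1 : ℝ) := by
  have hcont : Continuous fun t : ℝ => (|t - x| + c) ^ (-1 : ℝ) :=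
    Continuous.rpow_const (by fun_prop) fun t => Or.inl (by positivity)
  have hlog : ∫ u in c..(ℓ + c), u⁻¹ = Real.log ((ℓ + c) / c) :=
    integral_inv_of_pos hc (by positivity)
  have hright : ∫ t in x..(x + ℓ), (|t - x| + c) ^ (-1 : ℝ) = Real.log ((ℓ + c) / c) := by
    rw [← hlog, ← intervalIntegral.integral_congr (f := fun t => (t + (c - x))⁻¹),
      intervalIntegral.integral_comp_add_right fun u => u⁻¹]
    · congr 1 <;> ring
    · intro t ht
      rw [uIcc_of_le (by linarith)] at ht
      simp only [Real.rpow_neg_one, abs_of_nonneg (sub_nonneg.2 ht.1)]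
      congr 1; ring
  have hleft : ∫ t in (x - ℓ)..x, (|t - x| + c) ^ (-1 : ℝ) = Real.log ((ℓ + c) / c) := by
    rw [← hlog, ← intervalIntegral.integral_congr (f := fun t => ((x + c) - t)⁻¹),
      intervalIntegral.integral_comp_sub_left fun u => u⁻¹]
    · congr 1 <;> ring
    · intro t ht
      rw [uIcc_of_le (by linarith)] at ht
      simp only [Real.rpow_neg_one, abs_of_nonpos (sub_nonpos.2 ht.2)]
      congr 1; ring
  calc 2 * Real.log ((ℓ + c) / c) = ∫ t in (x - ℓ)..(x + ℓ), (|t - x| + c) ^ (-1 : ℝ) := by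
        rw [← intervalIntegral.integral_add_adjacent_intervals (hcont.intervalIntegrable _ x)
          (hcont.intervalIntegrable _ _), hleft, hright, two_mul]
    _ ≤ _ := intervalIntegral.integral_mono_interval ha (by linarith) hb
        (ae_of_all _ fun t => shifted_kernel_nonneg hc _) (hcont.intervalIntegrable _ _)

/-- Bound on the total mass of a charge on `{1, …, p}` with bounded Riesz potential, `ν = 1`. -/
lemma exists_sum_charge_le_of_eq_one {c θ : ℝ} (hc : 0 < c) (hθ : 0 < θ) :
    ∃ p₀ : ℝ, Real.exp 1 ≤ p₀ ∧ ∀ (p : ℕ) (A : Finset ℕ) (e : ℕ → ℝ) (D : ℝ), p₀ ≤ p →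
      A ⊆ Finset.Icc 1 p → (∀ j, 0 ≤ e j) →
      (∀ t : ℝ, ∑ j ∈ A, e j * (|t - j| + c) ^ (-1 : ℝ) ≤ D) →
      (1 - θ) * ∑ j ∈ A, e j ≤ 1 / 2 * (p / Real.log p) * D := by
  set R := 2 * |Real.log (θ / 4 / c)| / θ with hR
  refine ⟨max (Real.exp 1) (Real.exp R), le_max_left _ _, fun p A e D hp hA he hD => ?_⟩
  have hp0 : (0 : ℝ) < p := (Real.exp_pos 1).trans_le ((le_max_left _ _).trans hp)
  have hlog1 : 1 ≤ Real.log p := (Real.le_log_iff_exp_le hp0).2 ((le_max_left _ _).trans hp)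
  have hlogR : R ≤ Real.log p := (Real.le_log_iff_exp_le hp0).2 ((le_max_right _ _).trans hp)
  set ℓ := θ / 4 * p with hℓ
  have hℓ0 : 0 < ℓ := by positivity
  have hE : 0 ≤ ∑ j ∈ A, e j := Finset.sum_nonneg fun j _ => he j
  have hcont : ∀ j : ℕ, Continuous fun t : ℝ => e j * (|t - j| + c) ^ (-1 : ℝ) := fun j =>
    continuous_const.mul (Continuous.rpow_const (by fun_prop) fun t => Or.inl (by positivity))
  have hupper : ∑ j ∈ A, ∫ t in (-ℓ)..(p + ℓ), e j * (|t - j| + c) ^ (-1 : ℝ) ≤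
      (p + 2 * ℓ) * D := by
    rw [← intervalIntegral.integral_finsetSum fun j _ => (hcont j).intervalIntegrable _ _]
    calc ∫ t in (-ℓ)..(p + ℓ), ∑ j ∈ A, e j * (|t - j| + c) ^ (-1 : ℝ)
        ≤ ∫ _ in (-ℓ)..(p + ℓ), D := intervalIntegral.integral_mono_on (by linarith)
          ((continuous_finsetSum A fun j _ => hcont j).intervalIntegrable _ _)
          (by simp) fun t _ => hD t
      _ = (p + 2 * ℓ) * D := by
          rw [intervalIntegral.integral_const, smul_eq_mul]; ring
  have hlower : (∑ j ∈ A, e j) * (2 * Real.log ((ℓ + c) / c)) ≤ (p + 2 * ℓ) * D := by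
    refine le_trans ?_ hupper
    rw [Finset.sum_mul]
    refine Finset.sum_le_sum fun j hj => ?_
    rw [intervalIntegral.integral_const_mul]
    have hj' := Finset.mem_Icc.1 (hA hj)
    have hjp : (j : ℝ) ≤ p := by exact_mod_cast hj'.2
    have hj0 : (0 : ℝ) ≤ j := by positivity
    exact mul_le_mul_of_nonneg_left
      (le_integral_inv_shifted_abs hc hℓ0.le (by linarith) (by linarith)) (he j)
  have hloglow : Real.log p + Real.log (θ / 4 / c) ≤ Real.log ((ℓ + c) / c) := by
    rw [← Real.log_mul hp0.ne' (by positivity)]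
    refine Real.log_le_log (by positivity) ?_
    rw [mul_div_assoc', div_le_div_iff_of_pos_right hc]
    rw [hℓ]; linarith
  have hgap : (1 - θ) * (1 + θ / 2) * Real.log p ≤ Real.log ((ℓ + c) / c) := by
    refine le_trans ?_ hloglow
    rw [hR, div_le_iff₀ hθ] at hlogR
    have := neg_abs_le (Real.log (θ / 4 / c))
    nlinarith [mul_pos hθ hθ]
  have h2 : (1 - θ) * (∑ j ∈ A, e j) * (2 * Real.log p) ≤ p * D := by
    have h3 : (∑ j ∈ A, e j) * (2 * ((1 - θ) * (1 + θ / 2) * Real.log p)) ≤ (p + 2 * ℓ) * D :=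
      le_trans (by gcongr) hlower
    have h4 : (1 + θ / 2) * ((1 - θ) * (∑ j ∈ A, e j) * (2 * Real.log p)) ≤
        (1 + θ / 2) * (p * D) := by
      calc _ = (∑ j ∈ A, e j) * (2 * ((1 - θ) * (1 + θ / 2) * Real.log p)) := by ring
        _ ≤ (p + 2 * ℓ) * D := h3
        _ = _ := by rw [hℓ]; ring
    exact le_of_mul_le_mul_left h4 (by positivity)
  calc (1 - θ) * ∑ j ∈ A, e j
      = (1 - θ) * (∑ j ∈ A, e j) * (2 * Real.log p) / (2 * Real.log p) := by
        field_simp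
    _ ≤ p * D / (2 * Real.log p) := by gcongr
    _ = _ := by field_simp

/-- Bound on the total mass of a charge with bounded Riesz potential from the diagonal term. -/
lemma sum_charge_le {ν c D : ℝ} (hc : 0 < c) {p : ℕ} {A : Finset ℕ} (hA : A ⊆ Finset.Icc 1 p)
    {e : ℕ → ℝ} (he : ∀ j, 0 ≤ e j)
    (hD : ∀ t : ℝ, ∑ j ∈ A, e j * (|t - j| + c) ^ (-ν) ≤ D) (hD0 : 0 ≤ D) :
    ∑ j ∈ A, e j ≤ p * (c ^ ν * D) := by
  have hcard : (A.card : ℝ) ≤ p := by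
    have := Finset.card_le_card hA
    rw [Nat.card_Icc] at this
    exact_mod_cast this
  calc ∑ j ∈ A, e j ≤ A.card • (c ^ ν * D) := by
        refine Finset.sum_le_card_nsmul _ _ _ fun i hi => ?_
        have h1 : e i * (|(i : ℝ) - i| + c) ^ (-ν) ≤ D :=
          (Finset.single_le_sum (f := fun j : ℕ => e j * (|(i : ℝ) - j| + c) ^ (-ν))
            (fun j _ => mul_nonneg (he j) (shifted_kernel_nonneg hc _)) hi).trans (hD i)
        rw [sub_self, abs_zero, zero_add, Real.rpow_neg hc.le, ← div_eq_mul_inv,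
          div_le_iff₀ (by positivity)] at h1
        linarith
    _ ≤ p * (c ^ ν * D) := by
        rw [nsmul_eq_mul]; gcongr

end LineCharge


section Capacity

lemma kappaNu_pos {ν : ℝ} (h0 : 0 < ν) : 0 < kappaNu ν := by
  rcases lt_or_ge ν 1 with h1 | h1
  · have hcos : 0 < Real.cos (Real.pi * ν / 2) :=
      Real.cos_pos_of_mem_Ioo ⟨by nlinarith [Real.pi_pos], by nlinarith [Real.pi_pos]⟩
    have hG : 0 < Real.Gamma ((1 + ν) / 2) := Real.Gamma_pos_of_pos (by linarith)
    have hG' : 0 < Real.Gamma (1 + ν) := Real.Gamma_pos_of_pos (by linarith)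
    rw [kappaNu, if_pos h1]
    have := Real.pi_pos
    positivity
  · rw [kappaNu, if_neg h1.not_gt]; norm_num

lemma le_of_one_sub_mul_le {η E K : ℝ} (hη : η ∈ Ioo (0 : ℝ) 1) (hK : 0 ≤ K)
    (h : (1 - η / 8) * E ≤ K / (1 - η / 8)) : E ≤ (1 + η) * K := by
  obtain ⟨h0, h1⟩ := hη
  have ht : 0 < 1 - η / 8 := by linarith
  rw [le_div_iff₀ ht] at h
  have h2 : 1 ≤ (1 - η / 8) * (1 - η / 8) * (1 + η) := by nlinarith [mul_pos h0 h0]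
  have h3 : (1 - η / 8) * (1 - η / 8) * E ≤ (1 - η / 8) * (1 - η / 8) * ((1 + η) * K) := by
    nlinarith [mul_nonneg (sub_nonneg.2 h2) hK]
  exact le_of_mul_le_mul_left h3 (by positivity)

lemma nonempty_of_half_mul_le_card {A : Finset ℕ} {p : ℝ} (hp : 0 < p)
    (h : 1 / 2 * p ≤ (A.card : ℝ)) : A.Nonempty := by
  rw [← Finset.card_pos]
  have : (0 : ℝ) < A.card := by linarith
  exact_mod_cast this

end Capacity

/-- upper bound on the capacity of a union of spread-out sets,
Lemma `lem:capatube`, upper bound `eq:capunionbound2`. -/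
theorem statement9
    (V : Type) [MeasurableSpace V]
    (lam dd : V → V → ℝ) (P : V → Measure (ℕ → V)) (α ν c₃ C₃ : ℝ)
    (hSt : Standing lam dd P α ν c₃ C₃) :
    ∀ η δ : ℝ, η ∈ Set.Ioo (0:ℝ) 1 → δ ∈ Set.Ioo (0:ℝ) 1 →
    ∃ ca CP C₆ : ℝ, ca ∈ Set.Ioo (0:ℝ) 1 ∧ 0 < CP ∧ 0 < C₆ ∧
      (ν ≤ 1 → C₆ = CBeta ν c₃) ∧
      ∀ (N : ℝ) (Pn : ℕ) (A : Finset ℕ) (S : ℕ → Set V),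
        CP ≤ N → CP ≤ (Pn : ℝ) → (Pn : ℝ) ≤ N →
        A ⊆ Finset.Icc 1 Pn →
        ca * (Pn : ℝ) ≤ (A.card : ℝ) →
        (∀ i ∈ A, (S i).Finite ∧ (S i).Nonempty) →
        (∀ i ∈ A, ∀ j ∈ A, ∀ y ∈ S i, ∀ z ∈ S j,
          δ * |(i : ℝ) - (j : ℝ)| - 1 / δ ≤ dd y z ∧
          dd y z ≤ (|(i : ℝ) - (j : ℝ)| + 1 / δ) * (N / (Pn : ℝ))) →
        capa lam P (⋃ i ∈ A, S i) ≤ C₆ * (1 + η) * Fnu ν N (N / (Pn : ℝ)) := by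
  intro η δ hη hδ
  have hν := hSt.nu_pos
  have hc₃ := hSt.c₃_pos
  have hθ : 0 < η / 8 := by linarith [hη.1]
  have hθ1 : 0 < 1 - η / 8 := by linarith [hη.2]
  obtain ⟨c, hc, hline⟩ := hSt.exists_line_charge (η := η / 8) ⟨hθ, by linarith⟩ hδ
  rcases lt_trichotomy ν 1 with h1 | h1 | h1
  · obtain ⟨p₀, hp₀, hmass⟩ := exists_sum_charge_le_of_lt_one hν h1 hc hθ
    refine ⟨1 / 2, p₀, CBeta ν c₃, by norm_num, hp₀, div_pos (kappaNu_pos hν) hc₃,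
      fun _ => rfl, fun N p A S _ hp hpN hA hcard hS hd => ?_⟩
    have hp0 : (0 : ℝ) < p := hp₀.trans_le hp
    have hN0 : 0 < N := hp0.trans_le hpN
    obtain ⟨e, he, hcap, hpot⟩ := hline (N / p) A S ((one_le_div hp0).2 hpN)
      (nonempty_of_half_mul_le_card hp0 hcard) hS hd
    have hle := hmass p A e _ hp hA he hpot
    rw [hcap, Fnu, if_pos h1, mul_comm (CBeta ν c₃), mul_assoc]
    have hκ := kappaNu_pos hν
    refine le_of_one_sub_mul_le hη (by unfold CBeta; positivity) (hle.trans_eq ?_)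
    rw [CBeta, Real.div_rpow hN0.le hp0.le]
    have := Real.rpow_pos_of_pos hp0 ν
    field_simp
  · subst h1
    obtain ⟨p₀, hp₀, hmass⟩ := exists_sum_charge_le_of_eq_one hc hθ
    refine ⟨1 / 2, p₀, CBeta 1 c₃, by norm_num, (Real.exp_pos 1).trans_le hp₀,
      div_pos (kappaNu_pos hν) hc₃, fun _ => rfl, fun N p A S _ hp hpN hA hcard hS hd => ?_⟩
    have hp0 : (0 : ℝ) < p := (Real.exp_pos 1).trans_le (hp₀.trans hp)
    have hN0 : 0 < N := hp0.trans_le hpN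
    have hlog : 1 ≤ Real.log p := (Real.le_log_iff_exp_le hp0).2 (hp₀.trans hp)
    obtain ⟨e, he, hcap, hpot⟩ := hline (N / p) A S ((one_le_div hp0).2 hpN)
      (nonempty_of_half_mul_le_card hp0 hcard) hS hd
    have hle := hmass p A e _ hp hA he hpot
    rw [hcap, Fnu, if_neg (lt_irrefl _), if_pos rfl, div_div_cancel₀ hN0.ne', max_eq_right hlog,
      mul_comm (CBeta 1 c₃), mul_assoc]
    have hκ := kappaNu_pos hν
    refine le_of_one_sub_mul_le hη (by unfold CBeta; positivity) (hle.trans_eq ?_)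
    rw [CBeta, kappaNu, if_neg (lt_irrefl _), Real.rpow_one]
    field_simp
  · have hK : 0 < c ^ ν / ((1 - η / 8) * c₃) := by positivity
    refine ⟨1 / 2, 1, c ^ ν / ((1 - η / 8) * c₃), by norm_num, one_pos, hK,
      fun h => absurd h1 h.not_gt, fun N p A S _ hp hpN hA hcard hS hd => ?_⟩
    have hp0 : (0 : ℝ) < p := one_pos.trans_le hp
    have hN0 : 0 < N := hp0.trans_le hpN
    obtain ⟨e, he, hcap, hpot⟩ := hline (N / p) A S ((one_le_div hp0).2 hpN)
      (nonempty_of_half_mul_le_card hp0 hcard) hS hd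
    have hle := sum_charge_le hc hA he hpot (by positivity)
    rw [hcap, Fnu, if_neg h1.not_gt, if_neg h1.ne']
    calc ∑ j ∈ A, e j ≤ p * (c ^ ν * ((N / p) ^ ν / ((1 - η / 8) * c₃))) := hle
      _ = c ^ ν / ((1 - η / 8) * c₃) * 1 * (N * (N / p) ^ (ν - 1)) := by
        rw [Real.rpow_sub_one (by positivity)]
        field_simp
      _ ≤ c ^ ν / ((1 - η / 8) * c₃) * (1 + η) * (N * (N / p) ^ (ν - 1)) := by
        gcongr
        linarith [hη.1]

end Paper
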